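/- (Theorem 1, SP vs. DP under equal selection quality.) Let h ≥ 1 and let μ₁, μ₂ ∈ ℝʰ be unit vectors with μ₁ ≠ μ₂ and μ₁ ≠ −μ₂. Let m, m⁺, s, β be real numbers with 0 < m⁺ < m, 0 < s, β > 1, and let γ ∈ (0,1). Define w_SP = γ·μ₁ + (1 − γ)·μ₂ and w_DP = (γ·s·(β−1) + m⁺)·μ₁ + ((1−γ)·s·(β−1) + m − m⁺)·μ₂ (i.e. the dynamic-pruning embedding with ρ = γ). Then ⟨w_SP, μ₁⟩ / ‖w_SP‖ > ⟨w_DP, μ₁⟩ / ‖w_DP‖ if and only if γ > m⁺/m. In particular, whenever γ > m⁺/m, static pruning yields strictly higher cosine similarity with the true-positive direction than dynamic pruning with the same selection quality. -/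

import Mathlib

open scoped RealInnerProductSpace

/-- The map `u ↦ u / √(u² + k)` is strictly increasing for `k > 0`. -/
theorem strictMono_div_sqrt_sq_add {k : ℝ} (hk : 0 < k) :
    StrictMono fun u : ℝ => u / √(u ^ 2 + k) := by
  intro u v huv
  have hp : 0 < √(u ^ 2 + k) := by positivity
  have hq : 0 < √(v ^ 2 + k) := by positivity
  have hp2 : √(u ^ 2 + k) ^ 2 = u ^ 2 + k := Real.sq_sqrt (by positivity)
  have hq2 : √(v ^ 2 + k) ^ 2 = v ^ 2 + k := Real.sq_sqrt (by positivity)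
  simp only
  rw [div_lt_div_iff₀ hp hq]
  have hup : |u| ≤ √(u ^ 2 + k) := Real.abs_le_sqrt (by linarith)
  have hvq : |v| ≤ √(v ^ 2 + k) := Real.abs_le_sqrt (by linarith)
  set p := √(u ^ 2 + k)
  set q := √(v ^ 2 + k)
  have huv' : u * v ≤ p * q :=
    (le_abs_self _).trans (abs_mul u v ▸ mul_le_mul hup hvq (abs_nonneg v) hp.le)
  have key : (v * p - u * q) * (p + q) = (v - u) * (k + (p * q - u * v)) := by
    linear_combination v * hp2 - u * hq2
  have hpos : 0 < (v * p - u * q) * (p + q) := by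
    rw [key]
    exact mul_pos (sub_pos.2 huv) (by linarith)
  linarith [pos_of_mul_pos_left hpos (by positivity : 0 ≤ p + q)]

/-- The cosine similarity of a positive combination `a • x + b • y` of unit vectors with `x`,
as a function of the ratio `a / b`. -/
theorem inner_div_norm_smul_add_smul {E : Type*} [NormedAddCommGroup E] [InnerProductSpace ℝ E]
    {x y : E} (hx : ‖x‖ = 1) (hy : ‖y‖ = 1) (a : ℝ) {b : ℝ} (hb : 0 < b) :
    ⟪a • x + b • y, x⟫ / ‖a • x + b • y‖ =
      (a / b + ⟪x, y⟫) / √((a / b + ⟪x, y⟫) ^ 2 + (1 - ⟪x, y⟫ ^ 2)) := by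
  have hnorm : ‖a • x + b • y‖ = b * √((a / b + ⟪x, y⟫) ^ 2 + (1 - ⟪x, y⟫ ^ 2)) := by
    rw [← Real.sqrt_sq (norm_nonneg (a • x + b • y)), norm_add_sq_real, norm_smul, norm_smul,
      hx, hy, real_inner_smul_left, real_inner_smul_right, mul_one, mul_one, Real.norm_eq_abs,
      Real.norm_eq_abs, sq_abs, sq_abs]
    conv_rhs => rw [← Real.sqrt_sq hb.le, ← Real.sqrt_mul (sq_nonneg b)]
    rw [Real.sqrt_sq hb.le]
    congr 1
    field_simp
    ring
  have hinner : ⟪a • x + b • y, x⟫ = b * (a / b + ⟪x, y⟫) := by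
    rw [inner_add_left, real_inner_smul_left, real_inner_smul_left, real_inner_self_eq_norm_sq,
      hx, real_inner_comm]
    field_simp
  rw [hnorm, hinner, mul_div_mul_left _ _ hb.ne']

/-- Two unit vectors that are neither equal nor opposite have inner product in `(-1, 1)`. -/
theorem inner_sq_lt_one_of_norm_eq_one {E : Type*} [NormedAddCommGroup E] [InnerProductSpace ℝ E]
    {x y : E} (hx : ‖x‖ = 1) (hy : ‖y‖ = 1) (hne : x ≠ y) (hne' : x ≠ -y) :
    ⟪x, y⟫ ^ 2 < 1 := by
  have h1 : ⟪x, y⟫ < 1 := inner_lt_one_iff_real_of_norm_eq_one hx hy |>.2 hne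
  have h2 : ⟪x, -y⟫ < 1 :=
    inner_lt_one_iff_real_of_norm_eq_one hx ((norm_neg y).trans hy) |>.2 hne'
  rw [inner_neg_right] at h2
  nlinarith

theorem stmt_6 (h : ℕ) (hh : 1 ≤ h) (μ₁ μ₂ : EuclideanSpace ℝ (Fin h))
    (hμ₁ : ‖μ₁‖ = 1) (hμ₂ : ‖μ₂‖ = 1) (hne : μ₁ ≠ μ₂) (hne' : μ₁ ≠ -μ₂)
    (m mp s β γ : ℝ) (hmp : 0 < mp) (hm : mp < m) (hs : 0 < s) (hβ : 1 < β)
    (hγ : γ ∈ Set.Ioo (0 : ℝ) 1)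
    (wSP wDP : EuclideanSpace ℝ (Fin h))
    (hSP : wSP = γ • μ₁ + (1 - γ) • μ₂)
    (hDP : wDP = (γ * s * (β - 1) + mp) • μ₁ + ((1 - γ) * s * (β - 1) + m - mp) • μ₂) :
    (⟪wSP, μ₁⟫ / ‖wSP‖ > ⟪wDP, μ₁⟫ / ‖wDP‖ ↔ γ > mp / m) ∧
    (γ > mp / m → ⟪wSP, μ₁⟫ / ‖wSP‖ > ⟪wDP, μ₁⟫ / ‖wDP‖) := by
  have hb : 0 < 1 - γ := sub_pos.2 hγ.2
  have hd : 0 < (1 - γ) * s * (β - 1) + m - mp := by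
    have := mul_pos (mul_pos hb hs) (sub_pos.2 hβ)
    linarith
  have hk : 0 < 1 - ⟪μ₁, μ₂⟫ ^ 2 :=
    sub_pos.2 (inner_sq_lt_one_of_norm_eq_one hμ₁ hμ₂ hne hne')
  have main : ⟪wSP, μ₁⟫ / ‖wSP‖ > ⟪wDP, μ₁⟫ / ‖wDP‖ ↔ γ > mp / m := by
    rw [hSP, hDP, inner_div_norm_smul_add_smul hμ₁ hμ₂ _ hb,
      inner_div_norm_smul_add_smul hμ₁ hμ₂ _ hd, gt_iff_lt, gt_iff_lt]
    refine (strictMono_div_sqrt_sq_add hk).lt_iff_lt.trans ?_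
    rw [add_lt_add_iff_right, div_lt_div_iff₀ hd hb, div_lt_iff₀ (hmp.trans hm)]
    constructor <;> intro _ <;> linarith
  exact ⟨main, main.2⟩
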